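/- Under the stated block hypotheses, for all i, j ∈ {0,…,d−1} and all k = 1,…,d−1 the following identity holds: −(k−1) ω^{ki} F_{ij} + ω^{−1/m} [ Σ_{l=0, l≠i}^{d−1} ((ω^{ki} − ω^{kl})/(ω^{i} − ω^{l})) F_{il} F_{lj} + k ω^{(k−1)i} F_{ii} F_{ij} ] = −k ω^{1/m} ω^{(k+1)i} δ_{i,j} 1_D + ω^{kj} (Σ_{t=0}^{k} ω^{t(i−j)}) F_{ij}, where δ_{i,j} is the Kronecker delta and 1_D the D×D identity. -/

import Mathlib

open Matrix Kronecker

/-- `omg d t` is ω^t = exp(2πi·t/d), where ω = exp(2πi/d). -/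
noncomputable def omg (d : ℕ) (t : ℝ) : ℂ :=
  Complex.exp ((2 * Real.pi * t / d : ℝ) * Complex.I)

/-- The coefficient a_k = ω^{(2k−d)/(4m)} / (2 cos(π/(2m))). -/
noncomputable def acoef (d m k : ℕ) : ℂ :=
  omg d ((2 * (k : ℝ) - d) / (4 * m)) / ((2 * Real.cos (Real.pi / (2 * m)) : ℝ) : ℂ)

/-- `abar d m A B k` is Ābar^{(k)} = a_k A^k + conj(a_k) B^k. -/
noncomputable def abar {n : Type*} [Fintype n] [DecidableEq n] (d m : ℕ)
    (A B : Matrix n n ℂ) (k : ℕ) : Matrix n n ℂ :=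
  acoef d m k • A ^ k + (starRingEnd ℂ) (acoef d m k) • B ^ k

/-- Z_d = diag(1, ω, …, ω^{d−1}). -/
noncomputable def Zmat (d : ℕ) : Matrix (Fin d) (Fin d) ℂ :=
  Matrix.diagonal fun i => omg d (i : ℝ)

theorem omg_add (d : ℕ) (s t : ℝ) : omg d (s + t) = omg d s * omg d t := by
  unfold omg
  rw [← Complex.exp_add]
  congr 1
  push_cast
  ring

theorem omg_zero (d : ℕ) : omg d 0 = 1 := by
  simp [omg]

theorem omg_ne_zero (d : ℕ) (t : ℝ) : omg d t ≠ 0 :=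
  Complex.exp_ne_zero _

theorem omg_neg (d : ℕ) (t : ℝ) : omg d (-t) = (omg d t)⁻¹ := by
  apply eq_inv_of_mul_eq_one_left
  rw [← omg_add, neg_add_cancel, omg_zero]

theorem omg_nat_mul (d n : ℕ) (t : ℝ) : omg d (n * t) = omg d t ^ n := by
  unfold omg
  rw [← Complex.exp_nat_mul]
  congr 1
  push_cast
  ring

theorem conj_omg (d : ℕ) (t : ℝ) : (starRingEnd ℂ) (omg d t) = omg d (-t) := by
  unfold omg
  rw [← Complex.exp_conj]
  congr 1
  rw [map_mul, Complex.conj_I, Complex.conj_ofReal]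
  push_cast
  ring

theorem omg_natCast_injective {d : ℕ} (hd : d ≠ 0) :
    Function.Injective fun i : Fin d => omg d ((i : ℕ) : ℝ) := by
  intro i j hij
  have h (n : ℕ) : omg d n = Complex.exp (2 * Real.pi * Complex.I / d) ^ n := by
    have := omg_nat_mul d n 1
    rw [mul_one] at this
    rw [this]
    congr 1
    unfold omg
    congr 1
    push_cast
    ring
  simp only [h] at hij
  exact Fin.ext ((Complex.isPrimitiveRoot_exp d hd).pow_inj i.2 j.2 hij)

theorem acoef_eq {d m : ℕ} (k : ℕ) :
    acoef d m k = acoef d m 0 * omg d (1 / (2 * m)) ^ k := by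
  unfold acoef
  rw [← omg_nat_mul, div_mul_eq_mul_div, ← omg_add]
  congr 2
  push_cast
  by_cases hm : (m : ℝ) = 0
  · simp [hm]
  · field_simp
    ring

theorem conj_acoef_eq {d m : ℕ} (k : ℕ) :
    (starRingEnd ℂ) (acoef d m k) =
      (starRingEnd ℂ) (acoef d m 0) * (omg d (1 / (2 * m)))⁻¹ ^ k := by
  rw [acoef_eq, map_mul, map_pow, conj_omg, omg_neg]

theorem cos_pi_div_two_mul_ne_zero {m : ℕ} (hm : 2 ≤ m) :
    Real.cos (Real.pi / (2 * m)) ≠ 0 := by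
  have hm' : (2 : ℝ) ≤ m := by exact_mod_cast hm
  have hpi := Real.pi_pos
  apply ne_of_gt
  apply Real.cos_pos_of_mem_Ioo
  constructor
  · have : 0 < Real.pi / (2 * m) := by positivity
    linarith
  · apply div_lt_div_of_pos_left hpi <;> linarith

theorem acoef_zero_ne_zero {d m : ℕ} (hm : 2 ≤ m) : acoef d m 0 ≠ 0 := by
  unfold acoef
  refine div_ne_zero (omg_ne_zero _ _) ?_
  exact_mod_cast mul_ne_zero two_ne_zero (cos_pi_div_two_mul_ne_zero hm)

theorem acoef_zero_add_conj {d m : ℕ} (hd : d ≠ 0) (hm : 2 ≤ m) :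
    acoef d m 0 + (starRingEnd ℂ) (acoef d m 0) = 1 := by
  have hc : ((2 * Real.cos (Real.pi / (2 * m)) : ℝ) : ℂ) ≠ 0 := by
    exact_mod_cast mul_ne_zero two_ne_zero (cos_pi_div_two_mul_ne_zero hm)
  have hd' : (d : ℂ) ≠ 0 := by exact_mod_cast hd
  have hm' : (m : ℂ) ≠ 0 := by
    have : m ≠ 0 := by lia
    exact_mod_cast this
  unfold acoef
  rw [map_div₀, conj_omg, Complex.conj_ofReal, ← add_div, div_eq_one_iff_eq hc]
  push_cast
  rw [Complex.two_cos, add_comm]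
  unfold omg
  congr 2
  all_goals
    push_cast
    field_simp
    ring

theorem acoef_self {d m : ℕ} :
    acoef d m d = (starRingEnd ℂ) (acoef d m 0) := by
  unfold acoef
  rw [map_div₀, conj_omg, Complex.conj_ofReal]
  congr 2
  push_cast
  ring

theorem sub_mul_pow_mul_sub_eq_zero {R : Type*} [Ring R] {X Y : R} {k : ℕ}
    (h : (X - Y) * (X ^ k - Y ^ k) = 0)
    (h' : (X - Y) * (X ^ (k + 1) - Y ^ (k + 1)) = 0) :
    (X - Y) * X ^ k * (X - Y) = 0 := by
  have e : (X - Y) * X ^ k * (X - Y) =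
      (X - Y) * (X ^ (k + 1) - Y ^ (k + 1)) - (X - Y) * (X ^ k - Y ^ k) * Y := by
    simp only [pow_succ]
    noncomm_ring
  rw [e, h, h', zero_mul, sub_zero]

section Algebra

variable {R : Type*} [Ring R] [Algebra ℂ R]

theorem sub_mul_pow_sub_pow_eq_zero {p q : ℂ} (hpq : p + q = 1) (hp : p ≠ 0) (hq : q ≠ 0)
    {X Y : R} {k : ℕ}
    (h : (p • X + q • Y) * (p • X ^ k + q • Y ^ k) = p • X ^ (k + 1) + q • Y ^ (k + 1)) :
    (X - Y) * (X ^ k - Y ^ k) = 0 := by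
  obtain rfl : q = 1 - p := by rw [← hpq]; ring
  have key : (p * (1 - p)) • ((X - Y) * (X ^ k - Y ^ k)) = 0 := by
    rw [← sub_eq_zero] at h
    rw [← neg_eq_zero, ← h]
    simp only [mul_sub, sub_mul, mul_add, add_mul, smul_mul_assoc, mul_smul_comm, ← pow_succ']
    module
  exact (smul_eq_zero.1 key).resolve_left (mul_ne_zero hp hq)

theorem mul_pow_mul_of_sub_mul_pow_mul_sub {z : ℂ} (hz : z ≠ 0) {A B : R} {b : ℕ}
    (h : (z • A - z⁻¹ • B) * (z • A) ^ b * (z • A - z⁻¹ • B) = 0) :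
    B * A ^ b * B =
      z ^ 2 • (A ^ (b + 1) * B) + z ^ 2 • (B * A ^ (b + 1)) - z ^ 4 • A ^ (b + 2) := by
  have e : (z • A - z⁻¹ • B) * (z • A) ^ b * (z • A - z⁻¹ • B) =
      (z ^ b * (z⁻¹) ^ 2) • (B * A ^ b * B -
      (z ^ 2 • (A ^ (b + 1) * B) + z ^ 2 • (B * A ^ (b + 1)) - z ^ 4 • A ^ (b + 2))) := by
    have e2 : B * A ^ b * A = B * A ^ (b + 1) := by rw [mul_assoc, ← pow_succ]
    simp only [smul_pow, sub_mul, mul_sub, smul_mul_assoc, mul_smul_comm, e2, ← pow_succ', ← pow_succ]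
    match_scalars <;> field_simp
  rw [e, smul_eq_zero] at h
  exact sub_eq_zero.1 (h.resolve_left (by positivity))

theorem sum_pow_mul_pow_mul {c : ℂ} (hc : c ≠ 0) {A B : R} {k : ℕ}
    (h : ∀ b < k, B * A ^ b * B =
      c • (A ^ (b + 1) * B) + c • (B * A ^ (b + 1)) - c ^ 2 • A ^ (b + 2)) :
    (-((k : ℂ) - 1)) • (A ^ k * B) +
        c⁻¹ • ∑ a ∈ Finset.range k, A ^ a * (B * A ^ (k - 1 - a) * B) =
      (-(k : ℂ) * c) • A ^ (k + 1) + ∑ t ∈ Finset.range (k + 1), A ^ t * B * A ^ (k - t) := by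
  have e : ∀ a ∈ Finset.range k, A ^ a * (B * A ^ (k - 1 - a) * B) =
      c • (A ^ k * B) + c • (A ^ a * B * A ^ (k - a)) - c ^ 2 • A ^ (k + 1) := by
    intro a ha
    rw [Finset.mem_range] at ha
    rw [h _ (by lia), mul_sub, mul_add, mul_smul_comm, mul_smul_comm, mul_smul_comm,
      ← mul_assoc, ← mul_assoc, ← pow_add, ← pow_add,
      show k - 1 - a + 1 = k - a by lia, show a + (k - a) = k by lia,
      show a + (k - 1 - a + 2) = k + 1 by lia]
  rw [Finset.sum_congr rfl e, Finset.sum_range_succ, Finset.sum_sub_distrib,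
    Finset.sum_add_distrib, Finset.sum_const, Finset.sum_const, ← Finset.smul_sum,
    Finset.card_range, Nat.sub_self, pow_zero, mul_one, ← Nat.cast_smul_eq_nsmul ℂ,
    ← Nat.cast_smul_eq_nsmul ℂ]
  match_scalars <;> field_simp <;> ring

end Algebra

section Abar

variable {n : Type*} [Fintype n] [DecidableEq n] {d m : ℕ} {A B : Matrix n n ℂ}

theorem abar_eq (k : ℕ) :
    abar d m A B k = acoef d m 0 • (omg d (1 / (2 * m)) • A) ^ k +
      (starRingEnd ℂ) (acoef d m 0) • ((omg d (1 / (2 * m)))⁻¹ • B) ^ k := by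
  unfold abar
  rw [conj_acoef_eq k, acoef_eq k, smul_pow, smul_pow, smul_smul, smul_smul]

theorem abar_self (hd : d ≠ 0) (hm : 2 ≤ m) (hA : A ^ d = 1) (hB : B ^ d = 1) :
    abar d m A B d = 1 := by
  unfold abar
  rw [acoef_self, Complex.conj_conj, hA, hB, ← add_smul, add_comm,
    acoef_zero_add_conj hd hm, one_smul]

theorem abar_one_mul (hd : 2 ≤ d) (hm : 2 ≤ m) (hA : A ^ d = 1) (hB : B ^ d = 1)
    (hrel1 : ∀ k, 1 ≤ k → k ≤ d - 1 → abar d m A B k * abar d m A B (d - k) = 1)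
    (hrel2 : ∀ k, 1 ≤ k → k ≤ d - 1 → abar d m A B k = (abar d m A B 1) ^ k)
    {k : ℕ} (hk : k < d) :
    abar d m A B 1 * abar d m A B k = abar d m A B (k + 1) := by
  rcases Nat.eq_zero_or_pos k with rfl | hk0
  · have h0 : abar d m A B 0 = 1 := by
      rw [abar_eq, pow_zero, pow_zero, ← add_smul, acoef_zero_add_conj (by lia) hm, one_smul]
    rw [h0, mul_one]
  rcases Nat.lt_or_ge (k + 1) d with hlt | hge
  · rw [hrel2 k hk0 (by lia), hrel2 (k + 1) (by lia) (by lia), pow_succ']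
  · obtain rfl : d = k + 1 := by lia
    have := hrel1 1 le_rfl (by lia)
    rw [Nat.add_sub_cancel] at this
    rw [this, abar_self (by lia) hm hA hB]

theorem mul_pow_mul_of_abar (hd : 2 ≤ d) (hm : 2 ≤ m) (hA : A ^ d = 1) (hB : B ^ d = 1)
    (hrel1 : ∀ k, 1 ≤ k → k ≤ d - 1 → abar d m A B k * abar d m A B (d - k) = 1)
    (hrel2 : ∀ k, 1 ≤ k → k ≤ d - 1 → abar d m A B k = (abar d m A B 1) ^ k)
    {b : ℕ} (hb : b + 1 < d) :
    B * A ^ b * B = omg d (1 / m) • (A ^ (b + 1) * B) + omg d (1 / m) • (B * A ^ (b + 1)) -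
      omg d (1 / m) ^ 2 • A ^ (b + 2) := by
  have hz := omg_ne_zero d (1 / (2 * m))
  have hsq : omg d (1 / m) = omg d (1 / (2 * m)) ^ 2 := by
    rw [← omg_nat_mul]
    congr 1
    push_cast
    field_simp
  have key (k : ℕ) (hk : k < d) := sub_mul_pow_sub_pow_eq_zero
    (acoef_zero_add_conj (by lia) hm) (acoef_zero_ne_zero (d := d) hm)
    ((map_ne_zero _).2 (acoef_zero_ne_zero (d := d) hm)) (k := k)
    (X := omg d (1 / (2 * m)) • A) (Y := (omg d (1 / (2 * m)))⁻¹ • B)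
    (by
      have := abar_one_mul hd hm hA hB hrel1 hrel2 hk
      rwa [abar_eq 1, abar_eq k, abar_eq (k + 1), pow_one, pow_one] at this)
  rw [mul_pow_mul_of_sub_mul_pow_mul_sub hz
    (sub_mul_pow_mul_sub_eq_zero (key b (by lia)) (key (b + 1) hb)), hsq, ← pow_mul]

end Abar

theorem Zmat_kronecker_one_pow (d D k : ℕ) :
    (Zmat d ⊗ₖ (1 : Matrix (Fin D) (Fin D) ℂ)) ^ k =
      Matrix.diagonal fun x => omg d (x.1 : ℝ) ^ k := by
  rw [Zmat, ← Matrix.diagonal_one, Matrix.diagonal_kronecker_diagonal, Matrix.diagonal_pow]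
  congr 1
  ext x
  simp

theorem Zmat_kronecker_one_pow_self {d : ℕ} (hd : d ≠ 0) (D : ℕ) :
    (Zmat d ⊗ₖ (1 : Matrix (Fin D) (Fin D) ℂ)) ^ d = 1 := by
  have hd' : (d : ℂ) ≠ 0 := by exact_mod_cast hd
  rw [Zmat_kronecker_one_pow, ← Matrix.diagonal_one]
  congr 1
  ext x
  rw [← omg_nat_mul]
  unfold omg
  rw [Complex.exp_eq_one_iff]
  refine ⟨(x.1 : ℕ), ?_⟩
  push_cast
  field_simp

theorem mul_diagonal_mul_apply {d D : ℕ} {B : Matrix (Fin d × Fin D) (Fin d × Fin D) ℂ}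
    {F : Fin d → Fin d → Matrix (Fin D) (Fin D) ℂ}
    (hF : ∀ (i j : Fin d) (p q : Fin D), B (i, p) (j, q) = F i j p q) (w : Fin d → ℂ)
    (i j : Fin d) (p q : Fin D) :
    (B * Matrix.diagonal (fun x : Fin d × Fin D => w x.1) * B) (i, p) (j, q) =
      ∑ l, w l * (F i l * F l j) p q := by
  simp only [Matrix.mul_apply (M := B * _), Matrix.mul_diagonal, Fintype.sum_prod_type, hF,
    Matrix.mul_apply (M := F _ _), Finset.mul_sum]
  refine Finset.sum_congr rfl fun l _ => Finset.sum_congr rfl fun r _ => ?_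
  ring

/-- The block identity
−(k−1) ω^{ki} F_{ij} + ω^{−1/m} [ Σ_{l≠i} ((ω^{ki}−ω^{kl})/(ω^i−ω^l)) F_{il}F_{lj}
  + k ω^{(k−1)i} F_{ii}F_{ij} ]
= −k ω^{1/m} ω^{(k+1)i} δ_{ij} 1_D + ω^{kj} (Σ_{t=0}^{k} ω^{t(i−j)}) F_{ij}. -/
theorem stmt9 (d m D : ℕ) (hd : 2 ≤ d) (hm : 2 ≤ m) (hD : 1 ≤ D)
    (B : Matrix (Fin d × Fin D) (Fin d × Fin D) ℂ)
    (hB : B ∈ Matrix.unitaryGroup (Fin d × Fin D) ℂ) (hBd : B ^ d = 1)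
    (F : Fin d → Fin d → Matrix (Fin D) (Fin D) ℂ)
    (hF : ∀ (i j : Fin d) (p q : Fin D), B (i, p) (j, q) = F i j p q)
    (hrel1 : ∀ k, 1 ≤ k → k ≤ d - 1 →
      abar d m (Zmat d ⊗ₖ (1 : Matrix (Fin D) (Fin D) ℂ)) B k *
        abar d m (Zmat d ⊗ₖ (1 : Matrix (Fin D) (Fin D) ℂ)) B (d - k) = 1)
    (hrel2 : ∀ k, 1 ≤ k → k ≤ d - 1 →
      abar d m (Zmat d ⊗ₖ (1 : Matrix (Fin D) (Fin D) ℂ)) B k =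
        (abar d m (Zmat d ⊗ₖ (1 : Matrix (Fin D) (Fin D) ℂ)) B 1) ^ k) :
    ∀ (i j : Fin d) (k : ℕ), 1 ≤ k → k ≤ d - 1 →
      (-((k : ℂ) - 1) * omg d ((k : ℝ) * i)) • F i j +
        omg d (-(1 / (m : ℝ))) •
          (∑ l ∈ Finset.univ.erase i,
              ((omg d ((k : ℝ) * i) - omg d ((k : ℝ) * l)) /
                (omg d (i : ℝ) - omg d (l : ℝ))) • (F i l * F l j) +
            ((k : ℂ) * omg d (((k : ℝ) - 1) * i)) • (F i i * F i j)) =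
      (-(k : ℂ) * omg d (1 / (m : ℝ)) * omg d (((k : ℝ) + 1) * i) *
          (if i = j then 1 else 0)) • (1 : Matrix (Fin D) (Fin D) ℂ) +
        (omg d ((k : ℝ) * j) * ∑ t ∈ Finset.range (k + 1), omg d ((t : ℝ) * ((i : ℝ) - j))) •
          F i j := by
  intro i j k hk1 hk
  have hinj := omg_natCast_injective (d := d) (by lia)
  have hc := omg_ne_zero d (1 / m)
  have main := sum_pow_mul_pow_mul hc (k := k) fun b hb =>
    mul_pow_mul_of_abar hd hm (Zmat_kronecker_one_pow_self (by lia) D) hBd hrel1 hrel2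
      (b := b) (by lia)
  simp only [Zmat_kronecker_one_pow] at main
  ext p q
  have hBDB (e : ℕ) := mul_diagonal_mul_apply hF (fun l => omg d ((l : ℕ) : ℝ) ^ e)
  have h := congrFun (congrFun main (i, p)) (j, q)
  simp only [Matrix.add_apply, Matrix.smul_apply, Matrix.sum_apply, Matrix.diagonal_mul,
    Matrix.mul_diagonal, hBDB, hF, smul_eq_mul, Matrix.diagonal_apply, Prod.mk.injEq] at h
  have hpred : omg d (((k : ℝ) - 1) * i) = omg d (i : ℝ) ^ (k - 1) := by
    rw [← omg_nat_mul, Nat.cast_sub hk1, Nat.cast_one]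
  have hsucc : omg d (((k : ℝ) + 1) * i) = omg d (i : ℝ) ^ (k + 1) := by
    rw [← omg_nat_mul, Nat.cast_add, Nat.cast_one]
  have hquad : ∑ a ∈ Finset.range k, omg d (i : ℝ) ^ a *
        ∑ l : Fin d, omg d (l : ℝ) ^ (k - 1 - a) * (F i l * F l j) p q =
      ∑ l ∈ Finset.univ.erase i, (omg d (i : ℝ) ^ k - omg d (l : ℝ) ^ k) /
          (omg d (i : ℝ) - omg d (l : ℝ)) * (F i l * F l j) p q +
        k * omg d (i : ℝ) ^ (k - 1) * (F i i * F i j) p q := by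
    simp only [Finset.mul_sum]
    rw [Finset.sum_comm, ← Finset.sum_erase_add _ _ (Finset.mem_univ i)]
    congr 1
    · refine Finset.sum_congr rfl fun l hl => ?_
      have hne : omg d (i : ℝ) - omg d (l : ℝ) ≠ 0 :=
        sub_ne_zero.2 fun e => Finset.ne_of_mem_erase hl (hinj e).symm
      rw [← geom_sum₂_mul, mul_div_cancel_right₀ _ hne, Finset.sum_mul]
      exact Finset.sum_congr rfl fun a _ => by ring
    · rw [← geom_sum₂_self, Finset.sum_mul]
      exact Finset.sum_congr rfl fun a _ => by ring
  have hlin : omg d ((k : ℝ) * j) *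
        (∑ t ∈ Finset.range (k + 1), omg d ((t : ℝ) * ((i : ℝ) - j))) * F i j p q =
      ∑ t ∈ Finset.range (k + 1), omg d (i : ℝ) ^ t * F i j p q * omg d (j : ℝ) ^ (k - t) := by
    rw [Finset.mul_sum, Finset.sum_mul]
    refine Finset.sum_congr rfl fun t ht => ?_
    have htk : t ≤ k := Nat.lt_succ_iff.1 (Finset.mem_range.1 ht)
    rw [← omg_add, mul_right_comm, ← omg_nat_mul, ← omg_nat_mul, ← omg_add,
      Nat.cast_sub htk]
    congr 2
    ring
  rw [hquad, ← hlin] at h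
  simp only [Matrix.add_apply, Matrix.smul_apply, Matrix.sum_apply, smul_eq_mul, hpred, hsucc,
    omg_nat_mul d k, omg_neg, Matrix.one_apply] at h ⊢
  rw [← mul_assoc] at h
  rw [h]
  congr 1
  by_cases hij : i = j <;> by_cases hpq : p = q <;> simp [hij, hpq]
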